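/- Let H be a finite simple graph of order n. If the vertex set of H can be partitioned into two sets Y_1 and Y_2 such that both Y_1 and Y_2 are global offensive alliances in H, then for every r ≥ 1, γo(K_r □ H) ≤ ⌊r·n/2⌋, where K_r is the complete graph on r vertices and γo denotes the global offensive alliance number. -/

import Mathlib

open SimpleGraph

/-- `S` is a global offensive alliance in `G`: every vertex outside `S` has at least
one more neighbor inside `S` than outside `S`. -/
def IsGlobalOffensiveAlliance {V : Type*} (G : SimpleGraph V) (S : Set V) : Prop :=
  ∀ v ∉ S, (G.neighborSet v ∩ S).ncard ≥ (G.neighborSet v \ S).ncard + 1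

/-- `S` is a global strong offensive alliance in `G`. -/
def IsGlobalStrongOffensiveAlliance {V : Type*} (G : SimpleGraph V) (S : Set V) : Prop :=
  ∀ v ∉ S, (G.neighborSet v ∩ S).ncard ≥ (G.neighborSet v \ S).ncard

/-- The global offensive alliance number `γₒ(G)`. -/
noncomputable def globalOffensiveAllianceNumber {V : Type*} (G : SimpleGraph V) : ℕ :=
  sInf {n | ∃ S : Set V, IsGlobalOffensiveAlliance G S ∧ S.ncard = n}

/-- `S` is a dominating set in `G`. -/
def IsDominatingSet {V : Type*} (G : SimpleGraph V) (S : Set V) : Prop :=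
  ∀ v ∉ S, ∃ u ∈ S, G.Adj u v

/-- The domination number `γ(G)`. -/
noncomputable def dominationNumber {V : Type*} (G : SimpleGraph V) : ℕ :=
  sInf {n | ∃ S : Set V, IsDominatingSet G S ∧ S.ncard = n}

/-- `S` is an efficient dominating set: a dominating set whose closed neighborhoods
are pairwise disjoint. -/
def IsEfficientDominatingSet {V : Type*} (G : SimpleGraph V) (S : Set V) : Prop :=
  IsDominatingSet G S ∧
    S.Pairwise fun u w =>
      Disjoint (insert u (G.neighborSet u)) (insert w (G.neighborSet w))

theorem SimpleGraph.ncard_boxProd_neighborSet_inter {V W : Type*} [Finite V] [Finite W]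
    (G : SimpleGraph V) (H : SimpleGraph W) (v : V) (w : W) (S : Set (V × W)) :
    ((G.boxProd H).neighborSet (v, w) ∩ S).ncard =
      (G.neighborSet v ∩ {u | (u, w) ∈ S}).ncard +
        (H.neighborSet w ∩ {z | (v, z) ∈ S}).ncard := by
  have h : (G.boxProd H).neighborSet (v, w) ∩ S =
      (fun u => (u, w)) '' (G.neighborSet v ∩ {u | (u, w) ∈ S}) ∪
        (fun z => (v, z)) '' (H.neighborSet w ∩ {z | (v, z) ∈ S}) := by
    ext ⟨a, b⟩
    simp only [Set.mem_inter_iff, mem_neighborSet, boxProd_adj, Set.mem_union, Set.mem_image,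
      Set.mem_ofPred_eq, Prod.mk.injEq]
    aesop
  have hd : Disjoint ((fun u => (u, w)) '' (G.neighborSet v ∩ {u | (u, w) ∈ S}))
      ((fun z => (v, z)) '' (H.neighborSet w ∩ {z | (v, z) ∈ S})) := by
    rw [Set.disjoint_left]
    rintro _ ⟨u, ⟨hu, -⟩, rfl⟩ ⟨z, -, hz⟩
    obtain ⟨rfl, -⟩ := Prod.mk.inj hz
    exact G.loopless.irrefl _ hu
  rw [h, Set.ncard_union_eq hd (Set.toFinite _) (Set.toFinite _),
    Set.ncard_image_of_injective _ (Prod.mk_left_injective w),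
    Set.ncard_image_of_injective _ (Prod.mk_right_injective v)]

/-- The union `A × Y ∪ Aᶜ × Yᶜ` is a global offensive alliance in the box product. -/
theorem IsGlobalOffensiveAlliance.boxProd {V W : Type*} [Finite V] [Finite W]
    {G : SimpleGraph V} {H : SimpleGraph W} {A : Set V} {Y : Set W}
    (hA : IsGlobalStrongOffensiveAlliance G A) (hA' : IsGlobalStrongOffensiveAlliance G Aᶜ)
    (hY : IsGlobalOffensiveAlliance H Y) (hY' : IsGlobalOffensiveAlliance H Yᶜ) :
    IsGlobalOffensiveAlliance (G.boxProd H) {p | p.1 ∈ A ↔ p.2 ∈ Y} := by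
  rintro ⟨v, w⟩ hvw
  rw [Set.sdiff_eq, ncard_boxProd_neighborSet_inter, ncard_boxProd_neighborSet_inter]
  by_cases hv : v ∈ A
  · have hw : w ∉ Y := by simpa [hv] using hvw
    have h₁ := hA' v (by simpa using hv)
    have h₂ := hY w hw
    rw [Set.sdiff_eq] at h₁ h₂
    simp only [Set.mem_compl_iff, Set.mem_ofPred_eq, hv, hw, true_iff, iff_false]
    simp only [Set.compl_def, Set.mem_ofPred_eq, Set.ofPred_mem_eq, not_not] at h₁ h₂ ⊢
    omega
  · have hw : w ∈ Y := by simpa [hv] using hvw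
    have h₁ := hA v hv
    have h₂ := hY' w (by simpa using hw)
    rw [Set.sdiff_eq] at h₁ h₂
    simp only [Set.mem_compl_iff, Set.mem_ofPred_eq, hv, hw, false_iff, iff_true]
    simp only [Set.compl_def, Set.mem_ofPred_eq, Set.ofPred_mem_eq, not_not] at h₁ h₂ ⊢
    omega

theorem isGlobalStrongOffensiveAlliance_top {V : Type*} [Finite V] {A : Set V}
    (h : Aᶜ.ncard ≤ A.ncard + 1) :
    IsGlobalStrongOffensiveAlliance (⊤ : SimpleGraph V) A := by
  intro v hv
  have h₁ : (⊤ : SimpleGraph V).neighborSet v ∩ A = A := by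
    ext u
    simp only [Set.mem_inter_iff, mem_neighborSet, top_adj, and_iff_right_iff_imp]
    rintro hu rfl
    exact hv hu
  have h₂ : (⊤ : SimpleGraph V).neighborSet v \ A = Aᶜ \ {v} := by
    ext u
    simp [and_comm, eq_comm]
  have h₃ := Set.ncard_sdiff_singleton_of_mem (show v ∈ Aᶜ from hv)
  rw [h₁, h₂]
  omega

theorem globalOffensiveAllianceNumber_le {V : Type*} {G : SimpleGraph V} {S : Set V}
    (hS : IsGlobalOffensiveAlliance G S) : globalOffensiveAllianceNumber G ≤ S.ncard :=
  Nat.sInf_le ⟨S, hS, rfl⟩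

theorem stmt10 {W : Type*} [Fintype W] (H : SimpleGraph W) (r : ℕ) (hr : 1 ≤ r)
    (Y₁ Y₂ : Set W) (hdisj : Disjoint Y₁ Y₂) (hunion : Y₁ ∪ Y₂ = Set.univ)
    (hY₁ : IsGlobalOffensiveAlliance H Y₁) (hY₂ : IsGlobalOffensiveAlliance H Y₂) :
    globalOffensiveAllianceNumber ((⊤ : SimpleGraph (Fin r)).boxProd H) ≤
      r * Fintype.card W / 2 := by
  obtain rfl : Y₂ = Y₁ᶜ :=
    (IsCompl.compl_eq ⟨hdisj, codisjoint_iff.mpr hunion⟩).symm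
  obtain ⟨A, -, hA⟩ := Set.exists_subset_card_eq (s := (Set.univ : Set (Fin r))) (n := r / 2)
    (by simpa using Nat.div_le_self r 2)
  have hcard := Set.ncard_add_ncard_compl A
  rw [Nat.card_eq_fintype_card, Fintype.card_fin] at hcard
  have hA₁ := isGlobalStrongOffensiveAlliance_top (A := A) (by omega)
  have hA₂ := isGlobalStrongOffensiveAlliance_top (A := Aᶜ) (by rw [compl_compl]; omega)
  have h₁ := globalOffensiveAllianceNumber_le (.boxProd hA₁ hA₂ hY₁ hY₂)
  have h₂ := globalOffensiveAllianceNumber_le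
    (.boxProd hA₁ hA₂ hY₂ (by rwa [compl_compl]))
  have hc : {p : Fin r × W | p.1 ∈ A ↔ p.2 ∈ Y₁ᶜ} = {p | p.1 ∈ A ↔ p.2 ∈ Y₁}ᶜ := by
    ext p
    simp only [Set.mem_ofPred_eq, Set.mem_compl_iff]
    tauto
  have hsum := Set.ncard_add_ncard_compl {p : Fin r × W | p.1 ∈ A ↔ p.2 ∈ Y₁}
  rw [Nat.card_eq_fintype_card, Fintype.card_prod, Fintype.card_fin] at hsum
  rw [hc] at h₂
  omega
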